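/- Let g ∈ G be a p-regular element with conjugacy class C. Then the k-algebras kR_𝔭(G,C) and kR_𝔭(C_G(g),1) are isomorphic. Consequently ℓ_p(G,C) = ℓ_p(C_G(g),1) and ext_p^1(G,C) = ext_p^1(C_G(g),1). -/

import Mathlib

open scoped TensorProduct Classical

/-! Common definitions: the character ring of a finite group, following Bonnafé,
"On the character ring of a finite group". -/

/-- The set of characters of finite-dimensional `K`-linear representations of `G`. -/
def charSet (K G : Type u) [Field K] [Group G] : Set (G → K) :=
  {f | ∃ V : FDRep K G, f = FDRep.character V}

/-- The character ring `R(G)` of virtual characters, i.e. the subring of the `K`-algebra of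
functions `G → K` generated by the characters.  Over a splitting field of characteristic zero
this is exactly the set of `ℤ`-linear combinations of irreducible characters. -/
def charRing (K G : Type u) [Field K] [Group G] : Subring (G → K) :=
  Subring.closure (charSet K G)

/-- `g` is `p`-regular if its order is prime to `p`. -/
def IsPRegular (p : ℕ) {G : Type*} [Monoid G] (g : G) : Prop :=
  Nat.Coprime (orderOf g) p

/-- `g` is a `p`-element if its order is a power of `p`. -/
def IsPElement (p : ℕ) {G : Type*} [Monoid G] (g : G) : Prop :=
  ∃ n : ℕ, orderOf g = p ^ n

/-- The `p'`-part `g_{p'}` of an element `g` of a finite group:  writing `orderOf g = q * m'`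
with `q` the `p`-part of the order, this is `g ^ (q * u)` where `u` is the inverse of
`q` modulo `m'`; it is the unique `p`-regular power of `g` such that `g * g_{p'}⁻¹` is a
`p`-element commuting with it. -/
noncomputable def pPrimePart (p : ℕ) {G : Type*} [Group G] (g : G) : G :=
  g ^ (p ^ (orderOf g).factorization p *
      (((p : ZMod (orderOf g / p ^ (orderOf g).factorization p)) ^
        (orderOf g).factorization p)⁻¹).val)

/-- The `p'`-section `S_{p'}(C)` of the conjugacy class `C` of `g` : the set of all
`x ∈ G` whose `p'`-part lies in the class of `g`. -/
def pSection (p : ℕ) {G : Type*} [Group G] (g : G) : Set G :=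
  {x | IsConj g (pPrimePart p x)}

/-- The idempotent class function `e_C` attached to the class `C` of `g`:  the characteristic
function (with values in `K`) of the `p'`-section of `C`. -/
noncomputable def eFun (p : ℕ) (K : Type*) [Field K] {G : Type*} [Group G] (g : G) : G → K :=
  fun x => if IsConj g (pPrimePart p x) then 1 else 0

/-- The number of conjugacy classes of `G` contained in a subset `S`. -/
noncomputable def numClassesIn {G : Type*} [Group G] (S : Set G) : ℕ :=
  Nat.card {c : ConjClasses G // c.carrier ⊆ S}

/-- The image of the localization `𝒪_𝔭` in the fraction field `K`: fractions `a / b` with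
`b ∉ 𝔭`. -/
def locSet (𝒪 K : Type*) [CommRing 𝒪] [Field K] [Algebra 𝒪 K] (𝔭 : Ideal 𝒪) : Set K :=
  {x | ∃ a b : 𝒪, b ∉ 𝔭 ∧ x * algebraMap 𝒪 K b = algebraMap 𝒪 K a}

/-- `𝒪_𝔭 R(G)`: the `𝒪_𝔭`-span of the character ring inside class functions `G → K`,
realized as the subring generated by `𝒪_𝔭`-constants and characters. -/
def locCharRing (𝒪 : Type*) (K : Type u) [CommRing 𝒪] [Field K] [Algebra 𝒪 K] (𝔭 : Ideal 𝒪)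
    (G : Type u) [Group G] : Subring (G → K) :=
  Subring.closure ({f | ∃ x ∈ locSet 𝒪 K 𝔭, f = Function.const G x} ∪ charSet K G)

/-- The ideal `𝔭 · 𝒪_𝔭R(G)` of `𝒪_𝔭R(G)`, generated by the constants from `𝔭`. -/
def pConstIdeal (𝒪 : Type*) (K : Type u) [CommRing 𝒪] [Field K] [Algebra 𝒪 K] (𝔭 : Ideal 𝒪)
    (G : Type u) [Group G] : Ideal (locCharRing 𝒪 K 𝔭 G) :=
  Ideal.span {f | ∃ a ∈ 𝔭, (f : G → K) = Function.const G (algebraMap 𝒪 K a)}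

/-- `kR(G) = k ⊗_ℤ R(G)`, realized through the canonical identification
`k ⊗_ℤ R(G) ≅ 𝒪_𝔭R(G) ⧸ 𝔭·𝒪_𝔭R(G)` (where `k = 𝒪/𝔭`). -/
abbrev kCharRing (𝒪 : Type*) (K : Type u) [CommRing 𝒪] [Field K] [Algebra 𝒪 K] (𝔭 : Ideal 𝒪)
    (G : Type u) [Group G] :=
  locCharRing 𝒪 K 𝔭 G ⧸ pConstIdeal 𝒪 K 𝔭 G

/-- The ideal of `𝒪_𝔭R(G)` cutting out the block `R_𝔭(G, C)` with identity element the
idempotent `e : 𝒪_𝔭R(G)`, reduced mod `𝔭`:  the block `kR(G)·ē` is canonically the quotient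
by `𝔭·𝒪_𝔭R(G) + (1 - e)·𝒪_𝔭R(G)`. -/
def blockIdeal (𝒪 : Type*) (K : Type u) [CommRing 𝒪] [Field K] [Algebra 𝒪 K] (𝔭 : Ideal 𝒪)
    (G : Type u) [Group G] (e : locCharRing 𝒪 K 𝔭 G) : Ideal (locCharRing 𝒪 K 𝔭 G) :=
  pConstIdeal 𝒪 K 𝔭 G ⊔ Ideal.span {1 - e}

/-- The block `kR_𝔭(G, C) = kR(G)·ē_C` of `kR(G)`, as a (unital) `k`-algebra, realized as the
quotient of `𝒪_𝔭R(G)` by `𝔭·𝒪_𝔭R(G) + (1 - e_C)·𝒪_𝔭R(G)`. -/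
abbrev blockAlg (𝒪 : Type*) (K : Type u) [CommRing 𝒪] [Field K] [Algebra 𝒪 K] (𝔭 : Ideal 𝒪)
    (G : Type u) [Group G] (e : locCharRing 𝒪 K 𝔭 G) :=
  locCharRing 𝒪 K 𝔭 G ⧸ blockIdeal 𝒪 K 𝔭 G e

/-- The constants, as a ring morphism `𝒪 →+* 𝒪_𝔭R(G)`. -/
noncomputable def constRingHom (𝒪 : Type*) (K : Type u) [CommRing 𝒪] [Field K] [Algebra 𝒪 K]
    (𝔭 : Ideal 𝒪) [𝔭.IsMaximal] (G : Type u) [Group G] : 𝒪 →+* locCharRing 𝒪 K 𝔭 G where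
  toFun a := ⟨Function.const G (algebraMap 𝒪 K a),
    Subring.subset_closure (Or.inl ⟨algebraMap 𝒪 K a,
      ⟨a, 1, fun h => (Ideal.ne_top_iff_one 𝔭).mp (Ideal.IsMaximal.ne_top ‹_›) h, by simp⟩, rfl⟩)⟩
  map_one' := Subtype.ext (funext fun g => by simp)
  map_mul' a b := Subtype.ext (funext fun g => by simp)
  map_zero' := Subtype.ext (funext fun g => by simp)
  map_add' a b := Subtype.ext (funext fun g => by simp)

/-- The structural morphism giving quotients of `𝒪_𝔭R(G)` by ideals containing
`𝔭·𝒪_𝔭R(G)` (such as `kR(G)` and its blocks) their `k = 𝒪/𝔭`-algebra structure. -/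
noncomputable def kScalars (𝒪 : Type*) (K : Type u) [CommRing 𝒪] [Field K] [Algebra 𝒪 K]
    (𝔭 : Ideal 𝒪) [𝔭.IsMaximal] (G : Type u) [Group G]
    (I : Ideal (locCharRing 𝒪 K 𝔭 G)) (hI : pConstIdeal 𝒪 K 𝔭 G ≤ I) :
    (𝒪 ⧸ 𝔭) →+* (locCharRing 𝒪 K 𝔭 G ⧸ I) :=
  Ideal.Quotient.lift 𝔭 ((Ideal.Quotient.mk I).comp (constRingHom 𝒪 K 𝔭 G))
    (fun a ha => by
      simp only [RingHom.comp_apply]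
      exact Ideal.Quotient.eq_zero_iff_mem.mpr (hI (Ideal.subset_span ⟨a, ha, rfl⟩)))

/-- The `k`-algebra structure morphism of the block `kR_𝔭(G, C)`. -/
noncomputable def blockScalars (𝒪 : Type*) (K : Type u) [CommRing 𝒪] [Field K] [Algebra 𝒪 K]
    (𝔭 : Ideal 𝒪) [𝔭.IsMaximal] (G : Type u) [Group G] (e : locCharRing 𝒪 K 𝔭 G) :
    (𝒪 ⧸ 𝔭) →+* blockAlg 𝒪 K 𝔭 G e :=
  kScalars 𝒪 K 𝔭 G (blockIdeal 𝒪 K 𝔭 G e) le_sup_left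

/-- The Jacobson radical of a ring. -/
noncomputable def jacRad (A : Type*) [CommRing A] : Ideal A := (⊥ : Ideal A).jacobson

/-- The Loewy length of `A`: the least `n` with `(Rad A) ^ n = 0`. -/
noncomputable def loewyLength (A : Type*) [CommRing A] : ℕ :=
  sInf {n : ℕ | jacRad A ^ n = ⊥}

/-- `Rad A / (Rad A)²`. -/
noncomputable abbrev radQuotient (A : Type*) [CommRing A] :=
  jacRad A ⧸ (Submodule.comap (jacRad A).subtype (jacRad A ^ 2 : Ideal A))

/-- `dim_k Rad(A)/Rad(A)²`, the `k`-vector space structure being induced by a ring morphism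
`k →+* A`. -/
noncomputable def extDim (k : Type*) [CommRing k] {A : Type*} [CommRing A] (φ : k →+* A) : ℕ :=
  letI : Module k (radQuotient A) := Module.compHom _ φ
  Module.finrank k (radQuotient A)

/-- `dim_k A`, the `k`-vector space structure being induced by a ring morphism `k →+* A`. -/
noncomputable def kDim (k : Type*) [CommRing k] {A : Type*} [CommRing A] (φ : k →+* A) : ℕ :=
  letI : Module k A := Module.compHom _ φ
  Module.finrank k A

/-- `dim_k I` for an ideal `I` of `A`, the `k`-vector space structure being induced by a ring
morphism `k →+* A`. -/
noncomputable def idealKDim (k : Type*) [CommRing k] {A : Type*} [CommRing A] (φ : k →+* A)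
    (I : Ideal A) : ℕ :=
  letI : Module k I := Module.compHom _ φ
  Module.finrank k I

theorem map_pPrimePart (p : ℕ) {G H : Type*} [Group G] [Group H] (f : G →* H)
    (hf : Function.Injective f) (x : G) : f (pPrimePart p x) = pPrimePart p (f x) := by
  unfold pPrimePart
  rw [map_pow, orderOf_injective f hf]

theorem pPrimePart_conj (p : ℕ) {G : Type*} [Group G] (a x : G) :
    pPrimePart p (a * x * a⁻¹) = a * pPrimePart p x * a⁻¹ :=
  (map_pPrimePart p (MulAut.conj a).toMonoidHom (MulAut.conj a).injective x).symm

/-- The residual exponent in the definition of `pPrimePart` is inverse to the `p`-part. -/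
theorem natCast_zmod_mul_inv_val {p n : ℕ} (hp : p.Prime) (hn : n ≠ 0) :
    ((p ^ n.factorization p *
      (((p : ZMod (n / p ^ n.factorization p)) ^ n.factorization p)⁻¹).val : ℕ) :
        ZMod (n / p ^ n.factorization p)) = 1 := by
  have hpos : 0 < n / p ^ n.factorization p := Nat.ordCompl_pos p hn
  have : NeZero (n / p ^ n.factorization p) := ⟨hpos.ne'⟩
  rw [Nat.cast_mul, ZMod.natCast_val, ZMod.cast_id, ← Nat.cast_pow]
  exact ZMod.coe_mul_inv_eq_one _ ((Nat.coprime_ordCompl hp hn).pow_left _)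

/-- `p`-elements are exactly the elements with trivial `p'`-part. -/
theorem pPrimePart_eq_one_iff {p : ℕ} (hp : p.Prime) {G : Type*} [Group G] [Finite G] {x : G} :
    pPrimePart p x = 1 ↔ ∃ k, orderOf x = p ^ k := by
  have hn : orderOf x ≠ 0 := (orderOf_pos x).ne'
  have hmul : p ^ (orderOf x).factorization p * (orderOf x / p ^ (orderOf x).factorization p) =
    orderOf x := Nat.ordProj_mul_ordCompl_eq_self _ _
  have hpos : 0 < orderOf x / p ^ (orderOf x).factorization p := Nat.ordCompl_pos p hn
  constructor
  · intro h
    refine ⟨(orderOf x).factorization p, ?_⟩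
    have hdvd := orderOf_dvd_of_pow_eq_one h
    have h1 := (ZMod.natCast_eq_zero_iff _ _).2 ((Dvd.intro_left _ hmul).trans hdvd)
    rw [natCast_zmod_mul_inv_val hp hn] at h1
    have h2 : orderOf x / p ^ (orderOf x).factorization p = 1 := by
      have := (ZMod.natCast_eq_zero_iff 1 _).1 (by simpa using h1)
      exact Nat.dvd_one.1 this
    rw [h2, mul_one] at hmul
    exact hmul.symm
  · rintro ⟨k, hk⟩
    have h1 : orderOf x / p ^ (orderOf x).factorization p = 1 := by
      rw [hk, hp.factorization_pow, Finsupp.single_eq_same, Nat.div_self (pow_pos hp.pos _)]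
    rw [h1, mul_one] at hmul
    exact orderOf_dvd_iff_pow_eq_one.1 ((dvd_of_eq hmul.symm).trans (Dvd.intro _ rfl))

theorem commute_pPrimePart (p : ℕ) {G : Type*} [Group G] (x : G) :
    Commute x (pPrimePart p x) := (Commute.refl x).pow_right _

/-- A `p`-regular element `g` is the `p'`-part of `y` iff `g` commutes with `y` and
`g⁻¹ * y` is a `p`-element. -/
theorem pPrimePart_eq_iff {p : ℕ} (hp : p.Prime) {G : Type*} [Group G] [Finite G] {g : G}
    (hg : IsPRegular p g) {y : G} :
    pPrimePart p y = g ↔ Commute y g ∧ pPrimePart p (g⁻¹ * y) = 1 := by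
  have hn : orderOf y ≠ 0 := (orderOf_pos y).ne'
  have hmul : p ^ (orderOf y).factorization p * (orderOf y / p ^ (orderOf y).factorization p) =
    orderOf y := Nat.ordProj_mul_ordCompl_eq_self _ _
  constructor
  · rintro h
    have hc : Commute y g := h ▸ commute_pPrimePart p y
    refine ⟨hc, (pPrimePart_eq_one_iff hp).2 ?_⟩
    have hmod := ((ZMod.natCast_eq_natCast_iff _ 1 _).1
      ((natCast_zmod_mul_inv_val hp hn).trans Nat.cast_one.symm)).mul_left'
        (p ^ (orderOf y).factorization p)
    rw [hmul, mul_one] at hmod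
    have : (g⁻¹ * y) ^ p ^ (orderOf y).factorization p = 1 := by
      rw [(hc.symm.inv_left).mul_pow, inv_pow, inv_mul_eq_one, ← h, pPrimePart, ← pow_mul,
        pow_eq_pow_iff_modEq, mul_comm]
      exact hmod
    obtain ⟨k, -, hk⟩ := (Nat.dvd_prime_pow hp).1 (orderOf_dvd_of_pow_eq_one this)
    exact ⟨k, hk⟩
  · rintro ⟨hc, h⟩
    obtain ⟨k, hk⟩ := (pPrimePart_eq_one_iff hp).1 h
    have hc' : Commute g (g⁻¹ * y) := (Commute.refl g).inv_right.mul_right hc.symm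
    have hy : g * (g⁻¹ * y) = y := by group
    have hcop : Nat.Coprime (orderOf g) (orderOf (g⁻¹ * y)) := by
      rw [hk]; exact Nat.Coprime.pow_right _ hg
    have ho : orderOf y = orderOf g * p ^ k := by
      rw [← hk, ← hc'.orderOf_mul_eq_mul_orderOf_of_coprime hcop, hy]
    have hndvd : ¬ p ∣ orderOf g := fun hd =>
      hp.one_lt.ne' (Nat.Coprime.eq_one_of_dvd (Nat.Coprime.symm hg) hd)
    have hf : (orderOf y).factorization p = k := by
      rw [ho, Nat.factorization_mul (orderOf_pos g).ne' (pow_pos hp.pos _).ne',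
        Finsupp.add_apply, Nat.factorization_eq_zero_of_not_dvd hndvd, hp.factorization_pow]
      simp
    have hd : orderOf y / p ^ (orderOf y).factorization p = orderOf g := by
      rw [hf, ho, Nat.mul_div_cancel _ (pow_pos hp.pos _)]
    have h1 := natCast_zmod_mul_inv_val hp hn
    unfold pPrimePart
    set e := p ^ (orderOf y).factorization p *
      (((p : ZMod (orderOf y / p ^ (orderOf y).factorization p)) ^
        (orderOf y).factorization p)⁻¹).val with he
    have h2 : (g⁻¹ * y) ^ e = 1 := by
      apply orderOf_dvd_iff_pow_eq_one.1
      rw [hk, he, hf]; exact Dvd.intro _ rfl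
    have h3 : g ^ e = g := by
      conv_rhs => rw [← pow_one g]
      rw [pow_eq_pow_iff_modEq, ← hd, ← ZMod.natCast_eq_natCast_iff, Nat.cast_one]
      exact h1
    conv_lhs => rw [← hy]
    rw [hc'.mul_pow, h2, h3, mul_one]

theorem trace_rep_mem_charSet {K G V : Type u} [Field K] [Group G] [AddCommGroup V] [Module K V]
    [FiniteDimensional K V] (ρ : Representation K G V) :
    (fun x => LinearMap.trace K V (ρ x)) ∈ charSet K G :=
  ⟨FDRep.of ρ, rfl⟩

/-- The character afforded by the image of an idempotent endomorphism of a representation. -/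
theorem trace_rep_mul_idempotent_mem_charSet {K G V : Type u} [Field K] [Group G]
    [AddCommGroup V] [Module K V] [FiniteDimensional K V] (ρ : Representation K G V)
    (P : Module.End K V) (hP : P * P = P) (hc : ∀ x, Commute P (ρ x)) :
    (fun x => LinearMap.trace K V (ρ x * P)) ∈ charSet K G := by
  have hfix : ∀ v ∈ LinearMap.range P, P v = v := by
    rintro _ ⟨v, rfl⟩
    exact LinearMap.congr_fun hP v
  have hmem : ∀ x, ∀ v ∈ LinearMap.range P, ρ x v ∈ LinearMap.range P := by
    intro x v hv
    exact ⟨ρ x v, (LinearMap.congr_fun (hc x) v).trans (congrArg (ρ x) (hfix v hv))⟩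
  let σ : Representation K G (LinearMap.range P) :=
    { toFun := fun x => (ρ x).restrict (hmem x)
      map_one' := by ext v; simp
      map_mul' := fun x y => by ext v; simp }
  convert trace_rep_mem_charSet σ using 2 with x
  have hall : ∀ v, (ρ x * P) v ∈ LinearMap.range P := fun v => hmem x _ ⟨v, rfl⟩
  rw [← LinearMap.trace_restrict_eq_of_forall_mem (LinearMap.range P) (ρ x * P) hall]
  congr 1
  ext v
  exact congrArg (ρ x) (hfix v v.2)

theorem charSet_const_on_conj {K G : Type u} [Field K] [Group G] {χ : G → K}
    (hχ : χ ∈ charSet K G) (a x : G) : χ (a * x * a⁻¹) = χ x := by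
  obtain ⟨V, rfl⟩ := hχ
  exact FDRep.char_conj V x a

theorem charSet_comp {K G H : Type u} [Field K] [Group G] [Group H] (f : H →* G) {χ : G → K}
    (hχ : χ ∈ charSet K G) : (fun x => χ (f x)) ∈ charSet K H := by
  obtain ⟨V, rfl⟩ := hχ
  exact trace_rep_mem_charSet (V.ρ.comp f)

theorem one_mem_charSet {K G : Type u} [Field K] [Group G] : (1 : G → K) ∈ charSet K G := by
  convert trace_rep_mem_charSet (1 : Representation K G K) using 1
  ext x
  simp

theorem mul_mem_charSet {K G : Type u} [Field K] [Group G] {χ ψ : G → K}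
    (hχ : χ ∈ charSet K G) (hψ : ψ ∈ charSet K G) : χ * ψ ∈ charSet K G := by
  obtain ⟨V, rfl⟩ := hχ
  obtain ⟨W, rfl⟩ := hψ
  exact ⟨CategoryTheory.MonoidalCategoryStruct.tensorObj V W, (FDRep.char_tensor V W).symm⟩

/-- The trace of the endomorphism `φ ↦ A ∘ φ ∘ τ` of the space of functions `X → V`. -/
theorem trace_pi_comp {K V X : Type*} [Field K] [AddCommGroup V] [Module K V]
    [FiniteDimensional K V] [Fintype X] (τ : X → X) (A : Module.End K V)
    (T : Module.End K (X → V)) (hT : ∀ φ x, T φ x = A (φ (τ x))) :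
    LinearMap.trace K (X → V) T = ∑ x, if τ x = x then LinearMap.trace K V A else 0 := by
  let b := Module.finBasis K V
  rw [LinearMap.trace_eq_matrix_trace K (Pi.basis fun _ : X => b), Matrix.trace,
    Fintype.sum_sigma]
  refine Finset.sum_congr rfl fun x _ => ?_
  simp only [Matrix.diag_apply, LinearMap.toMatrix_apply, Pi.basis_repr, Pi.basis_apply, hT]
  split_ifs with h
  · rw [h, LinearMap.trace_eq_matrix_trace K b, Matrix.trace]
    simp [LinearMap.toMatrix_apply]
  · simp [Pi.single_eq_of_ne h]

/-- The induced class function, given by the usual formula. -/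
noncomputable def indFun {K G : Type*} [Field K] [Group G] [Fintype G] (H : Subgroup G) :
    (H → K) →ₗ[K] (G → K) where
  toFun f y := (Nat.card H : K)⁻¹ *
    ∑ x : G, if h : x * y * x⁻¹ ∈ H then f ⟨x * y * x⁻¹, h⟩ else 0
  map_add' f f' := by
    ext y
    simp only [Pi.add_apply, ← mul_add, ← Finset.sum_add_distrib]
    congr! 2 with x
    split_ifs <;> simp
  map_smul' c f := by
    ext y
    simp only [Pi.smul_apply, smul_eq_mul, RingHom.id_apply, Finset.mul_sum]
    congr! 1 with x
    split_ifs
    · ring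
    · simp

theorem indFun_mem_charSet {K G : Type u} [Field K] [CharZero K] [Group G] [Fintype G]
    (H : Subgroup G) {χ : H → K} (hχ : χ ∈ charSet K H) : indFun H χ ∈ charSet K G := by
  obtain ⟨V, rfl⟩ := hχ
  let R : Representation K G (G → V) :=
    { toFun := fun y => LinearMap.funLeft K V (· * y)
      map_one' := by ext φ x; simp [LinearMap.funLeft]
      map_mul' := fun y z => by ext φ x; simp [LinearMap.funLeft, mul_assoc] }
  let S : Representation K H (G → V) :=
    { toFun := fun h =>
        { toFun := fun φ x => V.ρ h (φ ((h : G)⁻¹ * x))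
          map_add' := fun φ φ' => by ext x; simp
          map_smul' := fun c φ => by ext x; simp }
      map_one' := by ext φ x; simp
      map_mul' := fun y z => by ext φ x; simp [mul_assoc] }
  have hcard : (Nat.card H : K) ≠ 0 := Nat.cast_ne_zero.2 Nat.card_pos.ne'
  let P : Module.End K (G → V) := (Nat.card H : K)⁻¹ • ∑ h : H, S h
  have hSP : ∀ h, S h * P = P := by
    intro h
    simp only [P, mul_smul_comm, Finset.mul_sum, ← map_mul]
    congr 1
    exact Fintype.sum_equiv (Equiv.mulLeft h) _ _ fun _ => rfl
  have hPP : P * P = P := by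
    conv_lhs => enter [1]; simp only [P]
    rw [smul_mul_assoc, Finset.sum_mul]
    simp only [hSP, Finset.sum_const, Finset.card_univ, ← Nat.card_eq_fintype_card]
    rw [← Nat.cast_smul_eq_nsmul K, smul_smul, inv_mul_cancel₀ hcard, one_smul]
  have hcomm : ∀ y, Commute P (R y) := by
    intro y
    refine Commute.smul_left (Commute.sum_left _ _ _ fun h _ => ?_) _
    refine LinearMap.ext fun φ => funext fun x => ?_
    simp [R, S, LinearMap.funLeft, mul_assoc]
  convert trace_rep_mul_idempotent_mem_charSet R P hPP hcomm using 1
  ext y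
  simp only [P, mul_smul_comm, Finset.mul_sum, map_smul, map_sum, smul_eq_mul]
  have htr : ∀ h : H, LinearMap.trace K (G → V) (R y * S h) =
      ∑ x : G, if (h : G)⁻¹ * (x * y) = x then V.character h else 0 := fun h =>
    trace_pi_comp (fun x => (h : G)⁻¹ * (x * y)) (V.ρ h) _ fun φ x => rfl
  simp only [htr]
  rw [← Finset.mul_sum, Finset.sum_comm]
  simp only [indFun, LinearMap.coe_mk, AddHom.coe_mk]
  congr! 2 with x
  have hiff : ∀ h : H, (h : G)⁻¹ * (x * y) = x ↔ (h : G) = x * y * x⁻¹ := fun h => by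
    rw [inv_mul_eq_iff_eq_mul, eq_mul_inv_iff_mul_eq, eq_comm]
  simp only [hiff]
  split_ifs with hx
  · rw [Finset.sum_eq_single ⟨x * y * x⁻¹, hx⟩]
    · simp
    · intro h _ hne
      rw [if_neg fun h' => hne (Subtype.ext h')]
    · simp
  · refine (Finset.sum_eq_zero fun h _ => ?_).symm
    exact if_neg fun h' => hx (by rw [← h']; exact h.2)

theorem smul_charSet_mem_locCharRing {𝒪 : Type*} {K G : Type u} [CommRing 𝒪] [Field K]
    [Algebra 𝒪 K] [Group G] {𝔭 : Ideal 𝒪} {c : K} (hc : c ∈ locSet 𝒪 K 𝔭) {χ : G → K}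
    (hχ : χ ∈ charSet K G) : c • χ ∈ locCharRing 𝒪 K 𝔭 G :=
  mul_mem (Subring.subset_closure (Or.inl ⟨c, hc, rfl⟩)) (Subring.subset_closure (Or.inr hχ))

theorem algebraMap_mem_locSet {𝒪 : Type*} {K : Type*} [CommRing 𝒪] [Field K] [Algebra 𝒪 K]
    {𝔭 : Ideal 𝒪} (h𝔭 : 𝔭 ≠ ⊤) (a : 𝒪) : algebraMap 𝒪 K a ∈ locSet 𝒪 K 𝔭 :=
  ⟨a, 1, fun h => (Ideal.ne_top_iff_one 𝔭).1 h𝔭 h, by simp⟩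

/-- `𝒪_𝔭 R(G)` is additively spanned by the `𝒪_𝔭`-multiples of characters. -/
theorem mem_addSubgroup_closure_of_mem_locCharRing {𝒪 : Type*} {K G : Type u} [CommRing 𝒪]
    [Field K] [Algebra 𝒪 K] [Group G] {𝔭 : Ideal 𝒪} [𝔭.IsPrime] {f : G → K}
    (hf : f ∈ locCharRing 𝒪 K 𝔭 G) :
    f ∈ AddSubgroup.closure {f : G → K | ∃ c ∈ locSet 𝒪 K 𝔭, ∃ χ ∈ charSet K G, f = c • χ} := by
  have hone : (1 : K) ∈ locSet 𝒪 K 𝔭 := by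
    simpa using algebraMap_mem_locSet (K := K) (Ideal.IsPrime.ne_top ‹𝔭.IsPrime›) 1
  refine AddSubgroup.closure_mono ?_ (Subring.mem_closure_iff.1 hf)
  intro f hf
  induction hf using Submonoid.closure_induction with
  | mem f hf =>
    rcases hf with ⟨c, hc, rfl⟩ | hχ
    · exact ⟨c, hc, 1, one_mem_charSet, by ext; simp⟩
    · exact ⟨1, hone, f, hχ, (one_smul _ _).symm⟩
  | one => exact ⟨1, hone, 1, one_mem_charSet, (one_smul _ _).symm⟩
  | mul f f' _ _ h h' =>
    obtain ⟨c, ⟨a, b, hb, hc⟩, χ, hχ, rfl⟩ := h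
    obtain ⟨c', ⟨a', b', hb', hc'⟩, χ', hχ', rfl⟩ := h'
    refine ⟨c * c', ⟨a * a', b * b', fun h => ?_, ?_⟩, χ * χ', mul_mem_charSet hχ hχ', ?_⟩
    · exact (Ideal.IsPrime.mem_or_mem ‹_› h).elim hb hb'
    · rw [map_mul, map_mul, mul_mul_mul_comm, hc, hc']
    · rw [smul_mul_smul_comm]

/-- A linear map sending characters of `G` into `𝒪_𝔭 R(H)` sends `𝒪_𝔭 R(G)` into
`𝒪_𝔭 R(H)`. -/
theorem map_mem_locCharRing {𝒪 : Type*} {K G H : Type u} [CommRing 𝒪] [Field K] [Algebra 𝒪 K]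
    [Group G] [Group H] {𝔭 : Ideal 𝒪} [𝔭.IsPrime] (T : (G → K) →ₗ[K] (H → K))
    (hT : ∀ χ ∈ charSet K G, T χ ∈ locCharRing 𝒪 K 𝔭 H) {f : G → K}
    (hf : f ∈ locCharRing 𝒪 K 𝔭 G) : T f ∈ locCharRing 𝒪 K 𝔭 H := by
  have hle : AddSubgroup.closure
      {f : G → K | ∃ c ∈ locSet 𝒪 K 𝔭, ∃ χ ∈ charSet K G, f = c • χ} ≤
      (locCharRing 𝒪 K 𝔭 H).toAddSubgroup.comap T.toAddMonoidHom := by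
    rw [AddSubgroup.closure_le]
    rintro _ ⟨c, hc, χ, hχ, rfl⟩
    change T (c • χ) ∈ locCharRing 𝒪 K 𝔭 H
    rw [map_smul]
    exact mul_mem (Subring.subset_closure (Or.inl ⟨c, hc, rfl⟩)) (hT χ hχ)
  exact hle (mem_addSubgroup_closure_of_mem_locCharRing hf)

theorem locCharRing_const_on_conj {𝒪 : Type*} {K G : Type u} [CommRing 𝒪] [Field K]
    [Algebra 𝒪 K] [Group G] {𝔭 : Ideal 𝒪} [𝔭.IsPrime] {f : G → K}
    (hf : f ∈ locCharRing 𝒪 K 𝔭 G) (a x : G) : f (a * x * a⁻¹) = f x := by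
  have hf' := mem_addSubgroup_closure_of_mem_locCharRing hf
  clear hf
  induction hf' using AddSubgroup.closure_induction with
  | mem f hf =>
    obtain ⟨c, -, χ, hχ, rfl⟩ := hf
    simp [charSet_const_on_conj hχ]
  | zero => rfl
  | add f f' _ _ h h' => simp only [Pi.add_apply, h, h']
  | neg f _ h => simp only [Pi.neg_apply, h]

theorem locCharRing_comp {𝒪 : Type*} {K G H : Type u} [CommRing 𝒪] [Field K] [Algebra 𝒪 K]
    [Group G] [Group H] {𝔭 : Ideal 𝒪} [𝔭.IsPrime] (φ : H →* G) {f : G → K}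
    (hf : f ∈ locCharRing 𝒪 K 𝔭 G) : (fun x => f (φ x)) ∈ locCharRing 𝒪 K 𝔭 H :=
  map_mem_locCharRing (LinearMap.funLeft K K φ)
    (fun _ hχ => Subring.subset_closure (Or.inr (charSet_comp φ hχ))) hf

theorem indFun_mem_locCharRing {𝒪 : Type*} {K G : Type u} [CommRing 𝒪] [Field K] [CharZero K]
    [Algebra 𝒪 K] [Group G] [Fintype G] {𝔭 : Ideal 𝒪} [𝔭.IsPrime] (H : Subgroup G) {f : H → K}
    (hf : f ∈ locCharRing 𝒪 K 𝔭 H) : indFun H f ∈ locCharRing 𝒪 K 𝔭 G :=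
  map_mem_locCharRing (indFun H)
    (fun _ hχ => Subring.subset_closure (Or.inr (indFun_mem_charSet H hχ))) hf

/-- Spectral decomposition of an endomorphism `T` with `T ^ N = 1`, in the presence of a
primitive `N`-th root of unity. -/
theorem exists_spectral_idempotents {K A : Type*} [Field K] [CharZero K] [Ring A] [Algebra K A]
    {N : ℕ} (hN : N ≠ 0) {ζ : K} (hζ : IsPrimitiveRoot ζ N) {T : A} (hT : T ^ N = 1) :
    ∃ P : ℕ → A, (∀ i, P i * P i = P i) ∧ (∀ i x, Commute T x → Commute (P i) x) ∧
      T = ∑ i ∈ Finset.range N, ζ ^ i • P i := by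
  have hNK : (N : K) ≠ 0 := Nat.cast_ne_zero.2 hN
  have hζ0 : ζ ≠ 0 := hζ.ne_zero hN
  let S : ℕ → A := fun i => (ζ⁻¹) ^ i • T
  have hSN : ∀ i, S i ^ N = 1 := fun i => by
    rw [smul_pow, hT, ← pow_mul, mul_comm, pow_mul, inv_pow, hζ.pow_eq_one]
    simp
  let Q : ℕ → A := fun i => ∑ j ∈ Finset.range N, S i ^ j
  have hSQ : ∀ i, S i * Q i = Q i := fun i => by
    have := mul_geom_sum (S i) N
    rw [hSN, sub_self, sub_mul, one_mul, sub_eq_zero] at this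
    exact this
  have hSjQ : ∀ i j, S i ^ j * Q i = Q i := fun i j => by
    induction j with
    | zero => simp
    | succ j ih => rw [pow_succ, mul_assoc, hSQ, ih]
  have hTS : ∀ i, T = ζ ^ i • S i := fun i => by
    simp only [S, smul_smul]
    rw [← mul_pow, mul_inv_cancel₀ hζ0, one_pow, one_smul]
  have hsum : ∑ i ∈ Finset.range N, Q i = (N : K) • (1 : A) := by
    simp only [Q]
    rw [Finset.sum_comm, Finset.sum_eq_single 0]
    · simp [Nat.cast_smul_eq_nsmul]
    · intro j hj hj0
      simp only [S, smul_pow]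
      rw [← Finset.sum_smul]
      convert zero_smul K _
      have hne : (ζ⁻¹) ^ j ≠ 1 :=
        hζ.inv.pow_ne_one_of_pos_of_lt hj0 (Finset.mem_range.1 hj)
      have hgeom := mul_geom_sum ((ζ⁻¹) ^ j) N
      rw [← pow_mul, mul_comm j, pow_mul, hζ.inv.pow_eq_one, one_pow, sub_self] at hgeom
      simp only [← pow_mul, mul_comm _ j]
      simp only [pow_mul]
      exact (mul_eq_zero.1 hgeom).resolve_left (sub_ne_zero.2 hne)
    · simp [hN]
  refine ⟨fun i => (N : K)⁻¹ • Q i, fun i => ?_, fun i x hx => ?_, ?_⟩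
  · have : Q i * Q i = (N : K) • Q i := by
      conv_lhs => enter [1]; simp only [Q]
      rw [Finset.sum_mul]
      simp [hSjQ, Nat.cast_smul_eq_nsmul]
    rw [smul_mul_smul_comm, this, smul_smul, mul_assoc, inv_mul_cancel₀ hNK, mul_one]
  · refine Commute.smul_left (Commute.sum_left _ _ _ fun j _ => ?_) _
    exact (hx.smul_left _).pow_left _
  · calc T = T * ((N : K)⁻¹ • ∑ i ∈ Finset.range N, Q i) := by
          rw [hsum, smul_smul, inv_mul_cancel₀ hNK, one_smul, mul_one]
      _ = ∑ i ∈ Finset.range N, ζ ^ i • (N : K)⁻¹ • Q i := by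
          rw [mul_smul_comm, Finset.mul_sum, Finset.smul_sum]
          refine Finset.sum_congr rfl fun i _ => ?_
          conv_lhs => rw [hTS i]
          rw [smul_mul_assoc, hSQ, smul_comm]

/-- `𝒪_𝔭 R(H)` is stable under translation by a central element. -/
theorem locCharRing_translate {𝒪 : Type*} {K H : Type u} [CommRing 𝒪] [IsDomain 𝒪]
    [IsIntegrallyClosed 𝒪] [Field K] [CharZero K] [Algebra 𝒪 K] [IsFractionRing 𝒪 K] [Group H]
    {𝔭 : Ideal 𝒪} [𝔭.IsPrime] {N : ℕ} (hN : N ≠ 0) {ζ : K} (hζ : IsPrimitiveRoot ζ N) {z : H}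
    (hz : ∀ x, Commute z x) (hzN : z ^ N = 1) {f : H → K} (hf : f ∈ locCharRing 𝒪 K 𝔭 H) :
    (fun x => f (z * x)) ∈ locCharRing 𝒪 K 𝔭 H := by
  refine map_mem_locCharRing (LinearMap.funLeft K K (z * ·)) ?_ hf
  rintro _ ⟨V, rfl⟩
  have hζint : ∀ i, ζ ^ i ∈ locSet 𝒪 K 𝔭 := fun i => by
    have h1 : IsIntegral 𝒪 (ζ ^ i) := by
      refine IsIntegral.of_pow (n := N) (Nat.pos_of_ne_zero hN) ?_
      rw [← pow_mul, mul_comm, pow_mul, hζ.pow_eq_one, one_pow]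
      exact isIntegral_one
    obtain ⟨a, ha⟩ := IsIntegrallyClosed.isIntegral_iff.1 h1
    exact ha ▸ algebraMap_mem_locSet (Ideal.IsPrime.ne_top ‹𝔭.IsPrime›) a
  obtain ⟨P, hPP, hPc, hP⟩ := exists_spectral_idempotents hN hζ
    (T := V.ρ z) (by rw [← map_pow, hzN, map_one])
  have hmem : ∀ i, (fun x => LinearMap.trace K V (V.ρ x * P i)) ∈ charSet K H := fun i =>
    trace_rep_mul_idempotent_mem_charSet V.ρ (P i) (hPP i)
      fun x => hPc i _ ((hz x).map V.ρ)
  have heq : LinearMap.funLeft K K (z * ·) V.character = ∑ i ∈ Finset.range N,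
      ζ ^ i • fun x => LinearMap.trace K V (V.ρ x * P i) := by
    ext x
    rw [Finset.sum_apply]
    simp only [Pi.smul_apply, ← map_smul, ← map_sum, ← mul_smul_comm, ← Finset.mul_sum, ← hP]
    change LinearMap.trace K V (V.ρ (z * x)) = _
    rw [← map_mul, (hz x).eq]
  rw [heq]
  exact sum_mem fun i _ => smul_charSet_mem_locCharRing (hζint i) (hmem i)

theorem jacRad_map {A B : Type*} [CommRing A] [CommRing B] (φ : A ≃+* B) :
    (jacRad A).map (φ : A →+* B) = jacRad B := by
  unfold jacRad
  rw [Ideal.map_jacobson_of_bijective φ.bijective, Ideal.map_bot]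

theorem loewyLength_congr {A B : Type*} [CommRing A] [CommRing B] (φ : A ≃+* B) :
    loewyLength A = loewyLength B := by
  unfold loewyLength
  congr 1
  ext n
  rw [Set.mem_ofPred_eq, Set.mem_ofPred_eq, ← jacRad_map φ, ← Ideal.map_pow,
    Ideal.map_eq_bot_iff_of_injective (f := (φ : A →+* B)) φ.injective]

theorem extDim_congr {k A B : Type*} [CommRing k] [CommRing A] [CommRing B] (φ : A ≃+* B)
    {σ : k →+* A} {τ : k →+* B} (h : φ.toRingHom.comp σ = τ) : extDim k σ = extDim k τ := by
  have hJ : ∀ a, φ a ∈ jacRad B ↔ a ∈ jacRad A := fun a => by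
    rw [← jacRad_map φ]
    exact ⟨fun ha => by
      obtain ⟨a', ha', haa'⟩ := (Ideal.mem_map_iff_of_surjective _ φ.surjective).1 ha
      exact φ.injective haa' ▸ ha', Ideal.mem_map_of_mem _⟩
  have hJ2 : ∀ a, φ a ∈ jacRad B ^ 2 ↔ a ∈ jacRad A ^ 2 := fun a => by
    rw [← jacRad_map φ, ← Ideal.map_pow]
    exact ⟨fun ha => by
      obtain ⟨a', ha', haa'⟩ := (Ideal.mem_map_iff_of_surjective _ φ.surjective).1 ha
      exact φ.injective haa' ▸ ha', Ideal.mem_map_of_mem _⟩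
  let e : jacRad A ≃+ jacRad B :=
    { toFun := fun a => ⟨φ a, (hJ a).2 a.2⟩
      invFun := fun b => ⟨φ.symm b, (hJ _).1 (by simp)⟩
      left_inv := fun a => by simp
      right_inv := fun b => by simp
      map_add' := fun a a' => by ext; simp }
  let E : radQuotient A ≃+ radQuotient B :=
    QuotientAddGroup.congr
      (Submodule.comap (jacRad A).subtype (jacRad A ^ 2 : Ideal A)).toAddSubgroup
      (Submodule.comap (jacRad B).subtype (jacRad B ^ 2 : Ideal B)).toAddSubgroup e (by
        ext b
        constructor
        · rintro ⟨a, ha, rfl⟩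
          exact (hJ2 a).2 ha
        · intro hb
          exact ⟨e.symm b, (hJ2 _).1 (by simpa [e] using hb), e.apply_symm_apply b⟩)
  have hE : ∀ (c : k) (x : radQuotient A), E (σ c • x) = τ c • E x := by
    intro c x
    obtain ⟨a, rfl⟩ := Submodule.Quotient.mk_surjective _ x
    change Submodule.Quotient.mk (e (σ c • a)) = Submodule.Quotient.mk (τ c • e a)
    congr 1
    ext
    simp [e, ← h]
  unfold extDim
  let _ : Module k (radQuotient A) := Module.compHom _ σ
  let _ : Module k (radQuotient B) := Module.compHom _ τ
  exact LinearEquiv.finrank_eq { E with map_smul' := hE }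

/-- A ring morphism `Φ : A → B` which is invertible after cutting by the idempotents `e` and
`e'` induces a surjection onto the cut quotient of `B`, with the expected kernel. -/
theorem surjective_and_ker_of_partial_inverse {A B : Type*} [CommRing A] [CommRing B]
    (Φ : A →+* B) (Ψ : B →+ A) {I : Ideal A} {J : Ideal B} {e : A} {e' : B}
    (hΦ : ∀ a ∈ I, Φ a ∈ J) (hΨ : ∀ b ∈ J, Ψ b ∈ I) (hΨe : ∀ b, Ψ ((1 - e') * b) = 0)
    (hΦe : Φ e * e' = e') (hΨΦ : ∀ a, Ψ (Φ a) = e * a) (hΦΨ : ∀ b, e' * Φ (Ψ b) = e' * b) :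
    Function.Surjective ((Ideal.Quotient.mk (J ⊔ Ideal.span {1 - e'})).comp Φ) ∧
      RingHom.ker ((Ideal.Quotient.mk (J ⊔ Ideal.span {1 - e'})).comp Φ) =
        I ⊔ Ideal.span {1 - e} := by
  constructor
  · intro x
    obtain ⟨b, rfl⟩ := Ideal.Quotient.mk_surjective x
    refine ⟨Ψ b, Ideal.Quotient.eq.2 (Ideal.mem_sup_right ?_)⟩
    refine Ideal.mem_span_singleton'.2 ⟨Φ (Ψ b) - b, ?_⟩
    linear_combination -hΦΨ b
  · refine le_antisymm (fun a ha => ?_) (sup_le (fun a ha => ?_) ?_)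
    · rw [RingHom.mem_ker, RingHom.comp_apply, Ideal.Quotient.eq_zero_iff_mem,
        Submodule.mem_sup] at ha
      obtain ⟨b, hb, c, hc, hbc⟩ := ha
      obtain ⟨d, rfl⟩ := Ideal.mem_span_singleton'.1 hc
      have h1 : e * a ∈ I := by
        rw [← hΨΦ, ← hbc, map_add, mul_comm d, hΨe, add_zero]
        exact hΨ b hb
      have h2 : a = e * a + a * (1 - e) := by ring
      rw [h2]
      exact Submodule.add_mem_sup h1 (Ideal.mem_span_singleton'.2 ⟨a, rfl⟩)
    · exact Ideal.Quotient.eq_zero_iff_mem.2 (Ideal.mem_sup_left (hΦ a ha))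
    · rw [Ideal.span_le, Set.singleton_subset_iff]
      refine Ideal.Quotient.eq_zero_iff_mem.2 (Ideal.mem_sup_right ?_)
      refine Ideal.mem_span_singleton'.2 ⟨Φ (1 - e), ?_⟩
      rw [map_sub, map_one]
      linear_combination hΦe

theorem map_mem_pConstIdeal {𝒪 : Type*} {K G H : Type u} [CommRing 𝒪] [Field K] [Algebra 𝒪 K]
    [Group G] [Group H] {𝔭 : Ideal 𝒪} (h𝔭 : 𝔭 ≠ ⊤)
    (Ψ : locCharRing 𝒪 K 𝔭 G →+ locCharRing 𝒪 K 𝔭 H)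
    (hΨ : ∀ (c : K) (f f' : locCharRing 𝒪 K 𝔭 G), (f' : G → K) = c • (f : G → K) →
      (Ψ f' : H → K) = c • (Ψ f : H → K))
    {f : locCharRing 𝒪 K 𝔭 G} (hf : f ∈ pConstIdeal 𝒪 K 𝔭 G) :
    Ψ f ∈ pConstIdeal 𝒪 K 𝔭 H := by
  suffices ∀ r, Ψ (r * f) ∈ pConstIdeal 𝒪 K 𝔭 H by simpa using this 1
  unfold pConstIdeal at hf
  induction hf using Submodule.span_induction with
  | mem f hf =>
    obtain ⟨a, ha, hfa⟩ := hf
    intro r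
    have hc : Function.const H (algebraMap 𝒪 K a) ∈ locCharRing 𝒪 K 𝔭 H :=
      Subring.subset_closure (Or.inl ⟨_, algebraMap_mem_locSet h𝔭 a, rfl⟩)
    have h1 : Ψ (r * f) = ⟨_, hc⟩ * Ψ r := by
      ext1
      rw [hΨ (algebraMap 𝒪 K a) r (r * f)]
      · rfl
      · rw [Subring.coe_mul, hfa, mul_comm]
        rfl
    rw [h1]
    exact Ideal.mul_mem_right _ _ (Ideal.subset_span ⟨a, ha, rfl⟩)
  | zero => simp
  | add x y _ _ hx hy =>
    intro r
    rw [mul_add, map_add]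
    exact add_mem (hx r) (hy r)
  | smul s x _ hx =>
    intro r
    rw [smul_eq_mul, ← mul_assoc]
    exact hx _

/-- Translation by a `p`-regular element `g` identifies the `p`-elements of the centralizer of
`g` with the elements of `p'`-part `g`. -/
theorem mem_centralizer_and_pPrimePart_iff {p : ℕ} (hp : p.Prime) {G : Type*} [Group G] [Finite G]
    {g : G} (hg : IsPRegular p g) {z : Subgroup.centralizer ({g} : Set G)} (hz : (z : G) = g)
    {y : G} :
    pPrimePart p y = g ↔
      ∃ h : y ∈ Subgroup.centralizer ({g} : Set G), pPrimePart p (z⁻¹ * ⟨y, h⟩) = 1 := by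
  rw [pPrimePart_eq_iff hp hg]
  have key : ∀ h : y ∈ Subgroup.centralizer ({g} : Set G),
      pPrimePart p (z⁻¹ * ⟨y, h⟩) = 1 ↔ pPrimePart p (g⁻¹ * y) = 1 := fun h => by
    rw [← (Subgroup.subtype_injective _).eq_iff, map_pPrimePart p _ (Subgroup.subtype_injective _)]
    simp [hz]
  have hmem : y ∈ Subgroup.centralizer ({g} : Set G) ↔ Commute y g := by
    rw [Subgroup.mem_centralizer_singleton_iff]
    exact Iff.rfl
  constructor
  · rintro ⟨h1, h2⟩
    exact ⟨hmem.2 h1, (key _).2 h2⟩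
  · rintro ⟨h1, h2⟩
    exact ⟨hmem.1 h1, (key h1).1 h2⟩

theorem sum_conj_eq {K G : Type*} [Field K] [Group G] [Fintype G] (g a : G) :
    (∑ x : G, if x * a * x⁻¹ = g then (1 : K) else 0) =
      if IsConj g a then (Nat.card (Subgroup.centralizer ({g} : Set G)) : K) else 0 := by
  split_ifs with h
  · obtain ⟨c, rfl⟩ := isConj_iff.1 h
    have hiff : ∀ x : G, x * (c * g * c⁻¹) * x⁻¹ = g ↔
        x * c ∈ Subgroup.centralizer ({g} : Set G) := fun x => by
      rw [Subgroup.mem_centralizer_singleton_iff, mul_inv_eq_iff_eq_mul, ← mul_assoc,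
        mul_inv_eq_iff_eq_mul, ← mul_assoc, mul_assoc g]
    simp only [hiff]
    refine (Equiv.sum_comp (Equiv.mulRight c)
      (fun x => if x ∈ Subgroup.centralizer ({g} : Set G) then (1 : K) else 0)).trans ?_
    rw [Finset.sum_boole, Nat.card_eq_fintype_card, Fintype.card_subtype]
  · refine Finset.sum_eq_zero fun x _ => if_neg fun hx => h ?_
    exact (isConj_iff.2 ⟨x, hx⟩).symm

theorem eFun_one_apply (p : ℕ) {K G : Type*} [Field K] [Group G] (x : G) :
    eFun p K (1 : G) x = if pPrimePart p x = 1 then 1 else 0 := by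
  unfold eFun
  congr 1
  exact propext ⟨fun h => isConj_one_right.1 h, fun h => h ▸ IsConj.refl _⟩

theorem indFun_translate_apply {p : ℕ} (hp : p.Prime) {K G : Type*} [Field K] [CharZero K]
    [Group G] [Fintype G] {g : G} (hg : IsPRegular p g)
    {z : Subgroup.centralizer ({g} : Set G)} (hz : (z : G) = g)
    (b : Subgroup.centralizer ({g} : Set G) → K) (y : G) (c : K)
    (hb : ∀ x (h : x * y * x⁻¹ ∈ Subgroup.centralizer ({g} : Set G)),
      pPrimePart p (x * y * x⁻¹) = g → b (z⁻¹ * ⟨x * y * x⁻¹, h⟩) = c) :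
    indFun (Subgroup.centralizer ({g} : Set G))
      (fun x => eFun p K (1 : Subgroup.centralizer ({g} : Set G)) (z⁻¹ * x) * b (z⁻¹ * x)) y =
      eFun p K g y * c := by
  have hcard : (Nat.card (Subgroup.centralizer ({g} : Set G)) : K) ≠ 0 :=
    Nat.cast_ne_zero.2 Nat.card_pos.ne'
  have hterm : ∀ x, (if h : x * y * x⁻¹ ∈ Subgroup.centralizer ({g} : Set G) then
      eFun p K (1 : Subgroup.centralizer ({g} : Set G)) (z⁻¹ * ⟨x * y * x⁻¹, h⟩) *
        b (z⁻¹ * ⟨x * y * x⁻¹, h⟩) else 0) =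
      (if x * pPrimePart p y * x⁻¹ = g then 1 else 0) * c := by
    intro x
    have hiff := mem_centralizer_and_pPrimePart_iff hp hg hz (y := x * y * x⁻¹)
    rw [← pPrimePart_conj]
    by_cases hx : pPrimePart p (x * y * x⁻¹) = g
    · obtain ⟨h, h'⟩ := hiff.1 hx
      rw [if_pos hx, dif_pos h, eFun_one_apply, if_pos h', hb x h hx]
    · rw [if_neg hx, zero_mul]
      split_ifs with h
      · rw [eFun_one_apply, if_neg fun h' => hx (hiff.2 ⟨h, h'⟩), zero_mul]
      · rfl
  simp only [indFun, LinearMap.coe_mk, AddHom.coe_mk]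
  rw [Finset.sum_congr rfl fun x _ => hterm x, ← Finset.sum_mul, sum_conj_eq]
  unfold eFun
  split_ifs
  · rw [← mul_assoc, inv_mul_cancel₀ hcard]
  · simp

variable {𝒪 : Type*} [CommRing 𝒪] [IsDomain 𝒪] [IsDedekindDomain 𝒪] [CharZero 𝒪]
variable {K : Type u} [Field K] [Algebra 𝒪 K] [IsFractionRing 𝒪 K]
variable {𝔭 : Ideal 𝒪} [𝔭.IsMaximal]

/-- Let `g ∈ G` be `p`-regular with class `C`.  Then the `k`-algebras
`kR_𝔭(G,C)` and `kR_𝔭(C_G(g),1)` are isomorphic; consequently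
`ℓ_p(G,C) = ℓ_p(C_G(g),1)` and `ext_p^1(G,C) = ext_p^1(C_G(g),1)`. -/
theorem block_iso_principal_block_of_centralizer
    (p : ℕ) [Fact p.Prime] (hp : (p : 𝒪) ∈ 𝔭)
    {G : Type u} [Group G] [Finite G]
    (ζ : K) (hζ : IsPrimitiveRoot ζ (Nat.card G))
    (g : G) (hg : IsPRegular p g)
    (heC : eFun p K g ∈ locCharRing 𝒪 K 𝔭 G)
    (he1 : eFun p K (1 : Subgroup.centralizer ({g} : Set G)) ∈
      locCharRing 𝒪 K 𝔭 (Subgroup.centralizer ({g} : Set G))) :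
    (∃ φ : blockAlg 𝒪 K 𝔭 G ⟨eFun p K g, heC⟩ ≃+*
        blockAlg 𝒪 K 𝔭 (Subgroup.centralizer ({g} : Set G))
          ⟨eFun p K (1 : Subgroup.centralizer ({g} : Set G)), he1⟩,
      φ.toRingHom.comp (blockScalars 𝒪 K 𝔭 G ⟨eFun p K g, heC⟩) =
        blockScalars 𝒪 K 𝔭 (Subgroup.centralizer ({g} : Set G))
          ⟨eFun p K (1 : Subgroup.centralizer ({g} : Set G)), he1⟩) ∧
    loewyLength (blockAlg 𝒪 K 𝔭 G ⟨eFun p K g, heC⟩) =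
      loewyLength (blockAlg 𝒪 K 𝔭 (Subgroup.centralizer ({g} : Set G))
        ⟨eFun p K (1 : Subgroup.centralizer ({g} : Set G)), he1⟩) ∧
    extDim (𝒪 ⧸ 𝔭) (blockScalars 𝒪 K 𝔭 G ⟨eFun p K g, heC⟩) =
      extDim (𝒪 ⧸ 𝔭) (blockScalars 𝒪 K 𝔭 (Subgroup.centralizer ({g} : Set G))
        ⟨eFun p K (1 : Subgroup.centralizer ({g} : Set G)), he1⟩) := by
  have hchar : CharZero K := charZero_of_injective_algebraMap (IsFractionRing.injective 𝒪 K)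
  have h𝔭 : 𝔭 ≠ ⊤ := Ideal.IsMaximal.ne_top ‹_›
  have hprime : p.Prime := Fact.out
  have hfin : Fintype G := Fintype.ofFinite G
  have hN : Nat.card G ≠ 0 := Nat.card_pos.ne'
  set H := Subgroup.centralizer ({g} : Set G)
  let z : H := ⟨g, Subgroup.mem_centralizer_singleton_iff.2 rfl⟩
  have hz : ∀ x : H, Commute z x := fun x =>
    Subtype.ext (Subgroup.mem_centralizer_singleton_iff.1 x.2).symm
  have hzN : z ^ Nat.card G = 1 := Subtype.ext (pow_card_eq_one' (x := g))
  have hgu : ∀ u : H, pPrimePart p u = 1 → pPrimePart p (g * (u : G)) = g := fun u hu =>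
    (mem_centralizer_and_pPrimePart_iff hprime hg (z := z) rfl).2
      ⟨(z * u).2, (congrArg (pPrimePart p) (inv_mul_cancel_left z u)).trans hu⟩
  have hΦmem : ∀ f ∈ locCharRing 𝒪 K 𝔭 G, (fun x : H => f (g * x)) ∈ locCharRing 𝒪 K 𝔭 H :=
    fun f hf => locCharRing_translate hN hζ hz hzN (locCharRing_comp H.subtype hf)
  have hΨmem : ∀ f ∈ locCharRing 𝒪 K 𝔭 H,
      indFun H (fun x => eFun p K (1 : H) (z⁻¹ * x) * f (z⁻¹ * x)) ∈ locCharRing 𝒪 K 𝔭 G :=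
    fun f hf => indFun_mem_locCharRing H (locCharRing_translate hN hζ
      (fun x => (hz x).inv_left) (by rw [inv_pow, hzN, inv_one]) (mul_mem he1 hf))
  let Φ : locCharRing 𝒪 K 𝔭 G →+* locCharRing 𝒪 K 𝔭 H :=
    { toFun := fun f => ⟨fun x => (f : G → K) (g * x), hΦmem f f.2⟩
      map_one' := rfl
      map_mul' := fun _ _ => rfl
      map_zero' := rfl
      map_add' := fun _ _ => rfl }
  have hadd : ∀ f f' : H → K,
      indFun H (fun x => eFun p K (1 : H) (z⁻¹ * x) * (f + f') (z⁻¹ * x)) =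
        indFun H (fun x => eFun p K (1 : H) (z⁻¹ * x) * f (z⁻¹ * x)) +
        indFun H (fun x => eFun p K (1 : H) (z⁻¹ * x) * f' (z⁻¹ * x)) := fun f f' => by
    rw [← map_add]
    congr 1
    ext x
    exact mul_add _ _ _
  let Ψ : locCharRing 𝒪 K 𝔭 H →+ locCharRing 𝒪 K 𝔭 G :=
    AddMonoidHom.mk' (fun f => ⟨_, hΨmem f f.2⟩) fun f f' => Subtype.ext (hadd f f')
  obtain ⟨hsurj, hker⟩ := surjective_and_ker_of_partial_inverse Φ Ψ
    (I := pConstIdeal 𝒪 K 𝔭 G) (J := pConstIdeal 𝒪 K 𝔭 H)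
    (e := ⟨eFun p K g, heC⟩) (e' := ⟨eFun p K (1 : H), he1⟩)
    (fun f hf => map_mem_pConstIdeal h𝔭 Φ.toAddMonoidHom (fun c f f' h => by
      ext x
      exact congrFun h (g * x)) hf)
    (fun f hf => map_mem_pConstIdeal h𝔭 Ψ (fun c f f' h => by
      change indFun H _ = c • indFun H _
      rw [h, ← map_smul]
      congr 1
      ext x
      exact mul_left_comm _ _ _) hf)
    (fun b => by
      ext1
      change indFun H _ = 0
      rw [← map_zero (indFun H)]
      congr 1
      ext x
      change eFun p K (1 : H) (z⁻¹ * x) * ((1 - eFun p K (1 : H) (z⁻¹ * x)) *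
        (b : H → K) (z⁻¹ * x)) = 0
      rw [eFun_one_apply]
      split_ifs <;> simp)
    (by
      ext x
      change eFun p K g (g * x) * eFun p K (1 : H) x = eFun p K (1 : H) x
      rw [eFun_one_apply]
      split_ifs with hx
      · rw [mul_one]
        refine if_pos ?_
        rw [hgu x hx]
      · rw [mul_zero])
    (fun f => by
      ext y
      refine indFun_translate_apply hprime hg rfl _ y _ fun x h _ => ?_
      change (f : G → K) (g * (g⁻¹ * (x * y * x⁻¹))) = _
      rw [mul_inv_cancel_left, locCharRing_const_on_conj f.2])
    (fun b => by
      ext u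
      change eFun p K (1 : H) u * indFun H _ (g * u) = eFun p K (1 : H) u * _
      rw [eFun_one_apply]
      split_ifs with hu
      · rw [indFun_translate_apply hprime hg rfl _ (g * u) ((b : H → K) u) fun x h hx => ?_]
        · rw [eFun, hgu u hu, if_pos (IsConj.refl g), one_mul]
        · rw [pPrimePart_conj, hgu u hu] at hx
          have hxH : x ∈ H :=
            Subgroup.mem_centralizer_singleton_iff.2 (mul_inv_eq_iff_eq_mul.1 hx)
          rw [← locCharRing_const_on_conj b.2 ⟨x, hxH⟩ u]
          refine congrArg (b : H → K) (Subtype.ext ?_)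
          change g⁻¹ * (x * (g * u) * x⁻¹) = x * u * x⁻¹
          rw [← mul_assoc x g, mul_inv_eq_iff_eq_mul.1 hx]
          group
      · rw [zero_mul, zero_mul])
  let φ : blockAlg 𝒪 K 𝔭 G ⟨eFun p K g, heC⟩ ≃+* blockAlg 𝒪 K 𝔭 H ⟨eFun p K (1 : H), he1⟩ :=
    (Ideal.quotEquivOfEq hker.symm).trans (RingHom.quotientKerEquivOfSurjective hsurj)
  have hφ : φ.toRingHom.comp (blockScalars 𝒪 K 𝔭 G ⟨eFun p K g, heC⟩) =
      blockScalars 𝒪 K 𝔭 H ⟨eFun p K (1 : H), he1⟩ := Ideal.Quotient.ringHom_ext rfl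
  exact ⟨⟨φ, hφ⟩, loewyLength_congr φ, extDim_congr φ hφ⟩
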